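/- Let c ∈ ℝ and d = c − 1. Then P_1^⊥(T_1) ∩ P_1^⊥(K_{c,c−1}) is one-dimensional, spanned by the quadratic polynomial q_2^{(c,c−1)}(x,y) := 28(6x² + 6cxy + c(c+1)y²) − 21(c+3)(2x+cy) + 3c² + 15c + 18. -/

import Mathlib

open MeasureTheory Finset

noncomputable section

/-- 2×2 determinant of two vectors in `ℝ²`. -/
def det2 (u v : ℝ × ℝ) : ℝ := u.1 * v.2 - u.2 * v.1

/-- The open triangle with vertices `A`, `B`, `C` (interior of the convex hull). -/
def tri (A B C : ℝ × ℝ) : Set (ℝ × ℝ) := interior (convexHull ℝ {A, B, C})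

/-- Barycentric coordinate of `p` with respect to the vertex `A` of triangle `ABC`. -/
def bary (A B C p : ℝ × ℝ) : ℝ := det2 (p - B) (C - B) / det2 (A - B) (C - B)

/-- The cubic bubble: product of the three barycentric coordinates of triangle `ABC`. -/
def bubble (A B C p : ℝ × ℝ) : ℝ := bary A B C p * bary B C A p * bary C A B p

/-- Evaluation of a bivariate polynomial at a point of `ℝ²`. -/
def evalP (u : MvPolynomial (Fin 2) ℝ) (p : ℝ × ℝ) : ℝ :=
  MvPolynomial.eval ![p.1, p.2] u

/-- The inner product `(u,v)_K := ∫_K u v ω_K` on the open triangle `K = conv°(A,B,C)`,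
with weight the product of the barycentric coordinates. -/
def innerT (A B C : ℝ × ℝ) (u v : MvPolynomial (Fin 2) ℝ) : ℝ :=
  ∫ p in tri A B C, evalP u p * evalP v p * bubble A B C p

/-- `u ∈ P_{n-1}^⊥(K)` for `K = conv°(A,B,C)`: `u` has total degree at most `n` and is
orthogonal to every polynomial of total degree at most `n-1` w.r.t. `(·,·)_K`. -/
def inPerp (n : ℕ) (A B C : ℝ × ℝ) (u : MvPolynomial (Fin 2) ℝ) : Prop :=
  u.totalDegree ≤ n ∧
    ∀ w : MvPolynomial (Fin 2) ℝ, w.totalDegree ≤ n - 1 → innerT A B C u w = 0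

/-- The quadratic polynomial
`q₂^{(c,c-1)}(x,y) = 28(6x² + 6cxy + c(c+1)y²) - 21(c+3)(2x+cy) + 3c² + 15c + 18`. -/
def q2c (c : ℝ) : MvPolynomial (Fin 2) ℝ :=
  MvPolynomial.C 28 *
      (MvPolynomial.C 6 * MvPolynomial.X 0 ^ 2 +
        MvPolynomial.C (6 * c) * MvPolynomial.X 0 * MvPolynomial.X 1 +
        MvPolynomial.C (c * (c + 1)) * MvPolynomial.X 1 ^ 2) -
    MvPolynomial.C (21 * (c + 3)) *
      (MvPolynomial.C 2 * MvPolynomial.X 0 + MvPolynomial.C c * MvPolynomial.X 1) +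
    MvPolynomial.C (3 * c ^ 2 + 15 * c + 18)

/-- The closed unit triangle. -/
def unitTriangle : Set (ℝ × ℝ) := {p | 0 ≤ p.1 ∧ 0 ≤ p.2 ∧ p.1 + p.2 ≤ 1}

theorem convexHull_unitTriangle :
    convexHull ℝ {((0 : ℝ), (0 : ℝ)), (1, 0), (0, 1)} = unitTriangle := by
  apply Set.Subset.antisymm
  · refine convexHull_min ?_ ?_
    · rintro p (rfl | rfl | rfl) <;> norm_num [unitTriangle]
    · rintro ⟨x, y⟩ ⟨h1, h2, h3⟩ ⟨x', y'⟩ ⟨h1', h2', h3'⟩ a b ha hb hab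
      simp only at h1 h2 h3 h1' h2' h3'
      refine ⟨?_, ?_, ?_⟩ <;> simp only [Prod.smul_mk, Prod.mk_add_mk, smul_eq_mul]
      · positivity
      · positivity
      · nlinarith
  · rintro ⟨x, y⟩ ⟨h1, h2, h3⟩
    simp only at h1 h2 h3
    rw [convexHull_insert (by simp), mem_convexJoin]
    refine ⟨_, rfl, ?_⟩
    rw [convexHull_pair]
    rcases eq_or_lt_of_le (add_nonneg h1 h2) with h | h
    · refine ⟨(1, 0), left_mem_segment _ _ _, ?_⟩
      have hx : x = 0 := by linarith
      have hy : y = 0 := by linarith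
      subst hx hy
      exact left_mem_segment _ _ _
    · refine ⟨(x / (x + y), y / (x + y)), ⟨x / (x + y), y / (x + y), by positivity,
        by positivity, by field_simp, by simp⟩, ⟨1 - (x + y), x + y, by linarith, h.le,
        by ring, ?_⟩⟩
      ext <;> simp <;> field_simp

theorem isCompact_unitTriangle : IsCompact unitTriangle := by
  rw [← convexHull_unitTriangle]
  exact (Set.toFinite _).isCompact_convexHull ℝ

theorem setIntegral_tri (A B C : ℝ × ℝ) (f : ℝ × ℝ → ℝ) :
    ∫ p in tri A B C, f p = ∫ p in convexHull ℝ {A, B, C}, f p :=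
  setIntegral_congr_set
    (interior_ae_eq_of_null_frontier ((convex_convexHull ℝ _).addHaar_frontier volume))

theorem setIntegral_unitTriangle {f : ℝ × ℝ → ℝ} (hf : Continuous f) :
    ∫ p in unitTriangle, f p = ∫ x in (0 : ℝ)..1, ∫ y in (0 : ℝ)..(1 - x), f (x, y) := by
  have hm : MeasurableSet unitTriangle := isCompact_unitTriangle.measurableSet
  have hint : Integrable (unitTriangle.indicator f) (volume.prod volume) :=
    (integrable_indicator_iff hm).2 (hf.continuousOn.integrableOn_compact isCompact_unitTriangle)
  rw [← integral_indicator hm, Measure.volume_eq_prod, integral_prod _ hint,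
    intervalIntegral.integral_of_le zero_le_one, ← integral_Icc_eq_integral_Ioc,
    ← integral_indicator measurableSet_Icc]
  congr 1
  ext x
  by_cases hx : x ∈ Set.Icc (0 : ℝ) 1
  · rw [Set.indicator_of_mem hx, intervalIntegral.integral_of_le (by linarith [hx.2]),
      ← integral_Icc_eq_integral_Ioc, ← integral_indicator measurableSet_Icc]
    congr 1
    ext y
    have : (x, y) ∈ unitTriangle ↔ y ∈ Set.Icc 0 (1 - x) := by
      simp only [unitTriangle, Set.mem_ofPred_eq, Set.mem_Icc, hx.1, true_and, le_sub_iff_add_le']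
    simp only [Set.indicator, this]
  · rw [Set.indicator_of_notMem hx]
    have (y : ℝ) : (x, y) ∉ unitTriangle := fun ⟨h1, h2, h3⟩ ↦
      hx ⟨h1, by simp only at h2 h3; linarith⟩
    simp [Set.indicator, this]

theorem integral_pow_mul_one_sub_pow (m n : ℕ) :
    ∫ x in (0 : ℝ)..1, x ^ m * (1 - x) ^ n =
      m.factorial * n.factorial / (m + n + 1).factorial := by
  induction n generalizing m with
  | zero =>
    simp only [pow_zero, mul_one, integral_pow, one_pow, ne_eq, Nat.add_eq_zero_iff, one_ne_zero,
      and_false, not_false_eq_true, zero_pow, sub_zero, Nat.factorial_zero, Nat.cast_one, add_zero,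
      Nat.factorial_succ, Nat.cast_mul, Nat.cast_add]
    have := m.factorial_ne_zero
    field_simp
  | succ n ih =>
    have hparts : ∫ x in (0 : ℝ)..1,
        ((m + 1) * (x ^ m * (1 - x) ^ (n + 1)) - (n + 1) * (x ^ (m + 1) * (1 - x) ^ n)) = 0 := by
      rw [intervalIntegral.integral_eq_sub_of_hasDerivAt
        (f := fun x ↦ x ^ (m + 1) * (1 - x) ^ (n + 1))]
      · simp
      · intro x _
        refine ((hasDerivAt_pow (m + 1) x).mul
          (((hasDerivAt_id x).const_sub 1).pow (n + 1))).congr_deriv ?_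
        simp
        ring
      · exact Continuous.intervalIntegrable (by fun_prop) _ _
    rw [intervalIntegral.integral_sub (Continuous.intervalIntegrable (by fun_prop) _ _)
      (Continuous.intervalIntegrable (by fun_prop) _ _), intervalIntegral.integral_const_mul,
      intervalIntegral.integral_const_mul, ih (m + 1)] at hparts
    have hm : (m + 1 : ℝ) ≠ 0 := by positivity
    apply mul_left_cancel₀ hm
    rw [sub_eq_zero.1 hparts, show m + 1 + n + 1 = m + (n + 1) + 1 by ring]
    simp only [Nat.factorial_succ m, Nat.factorial_succ n, Nat.cast_mul, Nat.cast_add,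
      Nat.cast_one]
    ring

theorem integral_monomial_mul_bubble (i j : ℕ) :
    ∫ p in unitTriangle, p.1 ^ i * p.2 ^ j * (p.1 * p.2 * (1 - p.1 - p.2)) =
      (i + 1).factorial * (j + 1).factorial / (i + j + 5).factorial := by
  rw [setIntegral_unitTriangle (by fun_prop)]
  have h2 : (j + 2 : ℝ) ≠ 0 := by positivity
  have h3 : (j + 3 : ℝ) ≠ 0 := by positivity
  have inner (x : ℝ) : ∫ y in (0 : ℝ)..(1 - x), x ^ i * y ^ j * (x * y * (1 - x - y)) =
      x ^ (i + 1) * (1 - x) ^ (j + 3) / ((j + 2) * (j + 3)) := by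
    rw [intervalIntegral.integral_eq_sub_of_hasDerivAt
      (f := fun y ↦ x ^ (i + 1) * ((1 - x) * (y ^ (j + 2) / (j + 2)) - y ^ (j + 3) / (j + 3)))]
    · simp
      field_simp
      ring
    · intro y _
      refine (((((hasDerivAt_pow (j + 2) y).div_const (j + 2 : ℝ)).const_mul (1 - x)).sub
        ((hasDerivAt_pow (j + 3) y).div_const
          (j + 3 : ℝ))).const_mul (x ^ (i + 1))).congr_deriv ?_
      push_cast
      field_simp
      ring
    · exact Continuous.intervalIntegrable (by fun_prop) _ _
  simp only [inner]
  rw [intervalIntegral.integral_div, integral_pow_mul_one_sub_pow,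
    show i + 1 + (j + 3) + 1 = i + j + 5 by ring, Nat.factorial_succ (j + 2),
    Nat.factorial_succ (j + 1)]
  push_cast
  field_simp
  ring

/-- The quadratic polynomial function with coefficients `a` in the basis
`1, x, y, x², xy, y²`. -/
def quadratic (a : Fin 6 → ℝ) (p : ℝ × ℝ) : ℝ :=
  a 0 + a 1 * p.1 + a 2 * p.2 + a 3 * p.1 ^ 2 + a 4 * (p.1 * p.2) + a 5 * p.2 ^ 2

theorem integral_quadratic_mul_linear_mul_bubble (a : Fin 6 → ℝ) (b₀ b₁ b₂ : ℝ) :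
    ∫ p in unitTriangle,
      quadratic a p * (b₀ + b₁ * p.1 + b₂ * p.2) * (p.1 * p.2 * (1 - p.1 - p.2)) =
    (b₀ * (84 * a 0 + 28 * a 1 + 28 * a 2 + 12 * a 3 + 8 * a 4 + 12 * a 5) +
      b₁ * (28 * a 0 + 12 * a 1 + 8 * a 2 + 6 * a 3 + 3 * a 4 + 3 * a 5) +
      b₂ * (28 * a 0 + 8 * a 1 + 12 * a 2 + 3 * a 3 + 3 * a 4 + 6 * a 5)) / 10080 := by
  let s : Finset (ℕ × ℕ) := {(0, 0), (1, 0), (0, 1), (2, 0), (1, 1), (0, 2), (3, 0), (2, 1),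
    (1, 2), (0, 3)}
  let k : ℕ → ℕ → ℝ := fun
    | 0, 0 => b₀ * a 0
    | 1, 0 => b₀ * a 1 + b₁ * a 0
    | 0, 1 => b₀ * a 2 + b₂ * a 0
    | 2, 0 => b₀ * a 3 + b₁ * a 1
    | 1, 1 => b₀ * a 4 + b₁ * a 2 + b₂ * a 1
    | 0, 2 => b₀ * a 5 + b₂ * a 2
    | 3, 0 => b₁ * a 3
    | 2, 1 => b₁ * a 4 + b₂ * a 3
    | 1, 2 => b₁ * a 5 + b₂ * a 4
    | 0, 3 => b₂ * a 5
    | _, _ => 0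
  have hexp (p : ℝ × ℝ) :
      quadratic a p * (b₀ + b₁ * p.1 + b₂ * p.2) * (p.1 * p.2 * (1 - p.1 - p.2)) =
      ∑ n ∈ s, k n.1 n.2 * (p.1 ^ n.1 * p.2 ^ n.2 * (p.1 * p.2 * (1 - p.1 - p.2))) := by
    simp [s, k, quadratic]
    ring
  simp only [hexp]
  rw [integral_finsetSum]
  · simp only [integral_const_mul, integral_monomial_mul_bubble]
    simp [s, k, Nat.factorial]
    ring
  · intro n _
    exact Continuous.continuousOn (by fun_prop) |>.integrableOn_compact isCompact_unitTriangle

theorem innerT_unit (u v : MvPolynomial (Fin 2) ℝ) :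
    innerT (0, 0) (1, 0) (0, 1) u v =
      ∫ p in unitTriangle, evalP u p * evalP v p * (p.1 * p.2 * (1 - p.1 - p.2)) := by
  rw [innerT, setIntegral_tri, convexHull_unitTriangle]
  congr 1
  ext p
  congr 1
  simp [bubble, bary, det2]
  ring

/-- The linear map carrying the unit triangle onto the triangle `(1,0)`, `(0,0)`, `(c,-1)`. -/
def shear (c : ℝ) : (ℝ × ℝ) →ₗ[ℝ] ℝ × ℝ where
  toFun p := (p.1 + c * p.2, -p.2)
  map_add' p q := by ext <;> simp <;> ring
  map_smul' t p := by ext <;> simp; ring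

theorem shear_apply (c : ℝ) (p : ℝ × ℝ) : shear c p = (p.1 + c * p.2, -p.2) := rfl

theorem shear_injective (c : ℝ) : Function.Injective (shear c) := by
  rintro ⟨x, y⟩ ⟨x', y'⟩ h
  simp only [shear_apply, Prod.mk.injEq, neg_inj] at h
  obtain ⟨h, rfl⟩ := h
  simpa using h

theorem det_shear (c : ℝ) : LinearMap.det (shear c) = -1 := by
  rw [← LinearMap.det_toMatrix (Module.Basis.finTwoProd ℝ), Matrix.det_fin_two]
  simp [LinearMap.toMatrix_apply, shear_apply]

theorem image_shear_unitTriangle (c : ℝ) :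
    shear c '' unitTriangle = convexHull ℝ {((1 : ℝ), (0 : ℝ)), (0, 0), (c, -1)} := by
  rw [← convexHull_unitTriangle, LinearMap.image_convexHull]
  simp only [Set.image_insert_eq, Set.image_singleton, shear_apply]
  norm_num [Set.insert_comm]

theorem innerT_sheared (c : ℝ) (u v : MvPolynomial (Fin 2) ℝ) :
    innerT (1, 0) (0, 0) (c, -1) u v =
      ∫ p in unitTriangle, evalP u (shear c p) * evalP v (shear c p) *
        (p.1 * p.2 * (1 - p.1 - p.2)) := by
  rw [innerT, setIntegral_tri, ← image_shear_unitTriangle,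
    ← LinearMap.coe_toContinuousLinearMap' (shear c), integral_image_eq_integral_abs_det_fderiv_smul volume isCompact_unitTriangle.measurableSet
      (fun p _ ↦ ((shear c).toContinuousLinearMap.hasFDerivAt (x := p)).hasFDerivWithinAt)
      (by simpa using (shear_injective c).injOn)]
  congr 1
  ext p
  have : (shear c).toContinuousLinearMap.det = -1 := det_shear c
  rw [this, abs_neg, abs_one, one_smul]
  congr 1
  simp [bubble, bary, det2, shear_apply]
  ring

theorem eq_sum_of_totalDegree_le {n : ℕ} {u : MvPolynomial (Fin 2) ℝ} (hu : u.totalDegree ≤ n) :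
    u = ∑ k ∈ range (n + 1), ∑ ij ∈ antidiagonal k,
      MvPolynomial.monomial (.single 0 ij.1 + .single 1 ij.2)
        (u.coeff (.single 0 ij.1 + .single 1 ij.2)) := by
  ext m
  have hm : Finsupp.single 0 (m 0) + Finsupp.single 1 (m 1) = m := by
    ext i
    fin_cases i <;> simp
  have heq (ij : ℕ × ℕ) : Finsupp.single 0 ij.1 + Finsupp.single 1 ij.2 = m ↔
      ij = (m 0, m 1) := by
    constructor
    · rintro rfl
      ext <;> simp
    · rintro rfl
      exact hm
  simp only [MvPolynomial.coeff_sum, MvPolynomial.coeff_monomial, heq, sum_ite_eq',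
    HasAntidiagonal.mem_antidiagonal, hm, sum_ite_eq, mem_range]
  split_ifs with h
  · rfl
  · apply MvPolynomial.coeff_eq_zero_of_totalDegree_lt
    have : ∑ i ∈ m.support, m i = m 0 + m 1 := by
      rw [← Fin.sum_univ_two]
      exact sum_subset (subset_univ _) (by simp)
    omega

open MvPolynomial in
/-- The polynomial `b₀ + b₁ x + b₂ y`. -/
def linearPoly (b₀ b₁ b₂ : ℝ) : MvPolynomial (Fin 2) ℝ := C b₀ + C b₁ * X 0 + C b₂ * X 1

theorem evalP_linearPoly (b₀ b₁ b₂ : ℝ) (p : ℝ × ℝ) :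
    evalP (linearPoly b₀ b₁ b₂) p = b₀ + b₁ * p.1 + b₂ * p.2 := by
  simp [evalP, linearPoly]

open MvPolynomial in
theorem totalDegree_linearPoly_le (b₀ b₁ b₂ : ℝ) :
    (linearPoly b₀ b₁ b₂).totalDegree ≤ 1 := by
  have hmul (t : ℝ) (i : Fin 2) : (C t * X i : MvPolynomial (Fin 2) ℝ).totalDegree ≤ 1 := by
    rw [C_mul']
    exact (totalDegree_smul_le t _).trans (totalDegree_X i).le
  exact (totalDegree_add _ _).trans
    (max_le ((totalDegree_add _ _).trans (max_le (by simp) (hmul _ _))) (hmul _ _))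

open MvPolynomial in
theorem exists_linear {u : MvPolynomial (Fin 2) ℝ} (hu : u.totalDegree ≤ 1) :
    ∃ b₀ b₁ b₂ : ℝ, u = linearPoly b₀ b₁ b₂ := by
  refine ⟨u.coeff 0, u.coeff (.single 0 1), u.coeff (.single 1 1), ?_⟩
  conv_lhs => rw [eq_sum_of_totalDegree_le hu]
  simp [sum_range_succ, Nat.antidiagonal_succ, monomial_eq, linearPoly]
  ring

open MvPolynomial in
/-- The quadratic polynomial with coefficients `a` in the basis `1, x, y, x², xy, y²`. -/
def quadraticPoly (a : Fin 6 → ℝ) : MvPolynomial (Fin 2) ℝ :=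
  C (a 0) + C (a 1) * X 0 + C (a 2) * X 1 + C (a 3) * X 0 ^ 2 + C (a 4) * (X 0 * X 1) +
    C (a 5) * X 1 ^ 2

theorem evalP_quadraticPoly (a : Fin 6 → ℝ) (p : ℝ × ℝ) :
    evalP (quadraticPoly a) p = quadratic a p := by
  simp [evalP, quadraticPoly, quadratic]

open MvPolynomial in
theorem exists_quadratic {u : MvPolynomial (Fin 2) ℝ} (hu : u.totalDegree ≤ 2) :
    ∃ a, u = quadraticPoly a := by
  refine ⟨![u.coeff 0, u.coeff (.single 0 1), u.coeff (.single 1 1), u.coeff (.single 0 2),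
    u.coeff (.single 0 1 + .single 1 1), u.coeff (.single 1 2)], ?_⟩
  conv_lhs => rw [eq_sum_of_totalDegree_le hu]
  simp [sum_range_succ, Nat.antidiagonal_succ, monomial_eq, quadraticPoly]
  ring

open MvPolynomial in
theorem totalDegree_quadraticPoly_le (a : Fin 6 → ℝ) : (quadraticPoly a).totalDegree ≤ 2 := by
  have hmul (t : ℝ) {f : MvPolynomial (Fin 2) ℝ} (hf : f.totalDegree ≤ 2) :
      (C t * f).totalDegree ≤ 2 := by
    rw [C_mul']
    exact (totalDegree_smul_le t f).trans hf
  have hX (i : Fin 2) : (X i : MvPolynomial (Fin 2) ℝ).totalDegree = 1 := totalDegree_X i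
  have hadd {f g : MvPolynomial (Fin 2) ℝ} (hf : f.totalDegree ≤ 2) (hg : g.totalDegree ≤ 2) :
      (f + g).totalDegree ≤ 2 := (totalDegree_add f g).trans (max_le hf hg)
  refine hadd (hadd (hadd (hadd (hadd ?_ (hmul _ ?_)) (hmul _ ?_)) (hmul _ ?_)) (hmul _ ?_))
    (hmul _ ?_)
  · simp
  · simp
  · simp
  · simp
  · exact (totalDegree_mul _ _).trans (by simp)
  · simp

/-- The linear conditions on the coefficients of a quadratic polynomial expressing orthogonality
to the polynomials of degree at most one on the unit triangle. -/
def IsOrthogonal (a : Fin 6 → ℝ) : Prop :=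
  a 1 = -(3 * a 3 + a 4) / 4 ∧ a 2 = -(3 * a 5 + a 4) / 4 ∧
    a 0 = (3 * a 3 + 2 * a 4 + 3 * a 5) / 28

theorem isOrthogonal_iff (a : Fin 6 → ℝ) :
    IsOrthogonal a ↔ ∀ b₀ b₁ b₂ : ℝ, ∫ p in unitTriangle,
      quadratic a p * (b₀ + b₁ * p.1 + b₂ * p.2) * (p.1 * p.2 * (1 - p.1 - p.2)) = 0 := by
  simp only [integral_quadratic_mul_linear_mul_bubble]
  constructor
  · rintro ⟨h1, h2, h0⟩ b₀ b₁ b₂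
    rw [h0, h1, h2]
    ring
  · intro h
    have e0 := h 1 0 0
    have e1 := h 0 1 0
    have e2 := h 0 0 1
    refine ⟨?_, ?_, ?_⟩ <;> linarith

theorem inPerp_unit_iff (a : Fin 6 → ℝ) :
    inPerp 2 (0, 0) (1, 0) (0, 1) (quadraticPoly a) ↔ IsOrthogonal a := by
  rw [inPerp, isOrthogonal_iff]
  simp only [totalDegree_quadraticPoly_le, true_and, innerT_unit, evalP_quadraticPoly]
  constructor
  · intro h b₀ b₁ b₂
    rw [← h (linearPoly b₀ b₁ b₂) (totalDegree_linearPoly_le _ _ _)]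
    simp only [evalP_linearPoly]
  · intro h w hw
    obtain ⟨b₀, b₁, b₂, rfl⟩ := exists_linear hw
    simp only [evalP_linearPoly, h]

/-- The coefficients of a quadratic polynomial precomposed with `shear c`. -/
def shearCoeff (c : ℝ) (a : Fin 6 → ℝ) : Fin 6 → ℝ :=
  ![a 0, a 1, c * a 1 - a 2, a 3, 2 * c * a 3 - a 4, c ^ 2 * a 3 - c * a 4 + a 5]

theorem quadratic_shear (c : ℝ) (a : Fin 6 → ℝ) (p : ℝ × ℝ) :
    quadratic a (shear c p) = quadratic (shearCoeff c a) p := by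
  simp [quadratic, shear_apply, shearCoeff]
  ring

theorem inPerp_sheared_iff (c : ℝ) (a : Fin 6 → ℝ) :
    inPerp 2 (1, 0) (0, 0) (c, -1) (quadraticPoly a) ↔ IsOrthogonal (shearCoeff c a) := by
  rw [inPerp, isOrthogonal_iff]
  simp only [totalDegree_quadraticPoly_le, true_and, innerT_sheared, evalP_quadraticPoly,
    quadratic_shear]
  constructor
  · intro h b₀ b₁ b₂
    rw [← h (linearPoly b₀ b₁ (c * b₁ - b₂)) (totalDegree_linearPoly_le _ _ _)]
    congr 1
    ext p
    simp only [evalP_linearPoly, shear_apply]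
    ring
  · intro h w hw
    obtain ⟨b₀, b₁, b₂, rfl⟩ := exists_linear hw
    rw [← h b₀ b₁ (c * b₁ - b₂)]
    congr 1
    ext p
    simp only [evalP_linearPoly, shear_apply]
    ring

open MvPolynomial in
theorem smul_q2c (t c : ℝ) : t • q2c c = quadraticPoly
    ![t * (3 * c ^ 2 + 15 * c + 18), t * (-42 * (c + 3)), t * (-21 * c * (c + 3)), t * 168,
      t * (168 * c), t * (28 * c * (c + 1))] := by
  apply MvPolynomial.funext
  intro x
  simp [q2c, quadraticPoly]
  ring

theorem isOrthogonal_and_shearCoeff_iff (c : ℝ) (a : Fin 6 → ℝ) :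
    IsOrthogonal a ∧ IsOrthogonal (shearCoeff c a) ↔
      ∃ t : ℝ, a = ![t * (3 * c ^ 2 + 15 * c + 18), t * (-42 * (c + 3)),
        t * (-21 * c * (c + 3)), t * 168, t * (168 * c), t * (28 * c * (c + 1))] := by
  constructor
  · rintro ⟨⟨h1, h2, h0⟩, h1', h2', h0'⟩
    simp only [shearCoeff, Matrix.cons_val] at h1' h2' h0'
    have h4 : a 4 = c * a 3 := by linarith
    rw [h4] at h1 h2 h0 h2'
    rw [h1, h2] at h2'
    have h5 : a 5 = c * (c + 1) * a 3 / 6 := by linarith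
    refine ⟨a 3 / 168, ?_⟩
    ext i
    fin_cases i <;> simp [h0, h1, h2, h4, h5] <;> ring
  · rintro ⟨t, rfl⟩
    simp only [IsOrthogonal, shearCoeff, Matrix.cons_val]
    refine ⟨⟨?_, ?_, ?_⟩, ?_, ?_, ?_⟩ <;> ring

theorem q2c_ne_zero (c : ℝ) : q2c c ≠ 0 := by
  intro h
  have h0 := congrArg (evalP · (0, 0)) h
  have h1 := congrArg (evalP · (1, 0)) h
  have h2 := congrArg (evalP · (2, 0)) h
  simp [evalP, q2c] at h0 h1 h2
  linarith

/-- For `c ∈ ℝ` and `d = c - 1`, the space `P_1^⊥(T₁) ∩ P_1^⊥(K_{c,c-1})`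
is one-dimensional, spanned by `q₂^{(c,c-1)}`.
Here `K_{c,c-1} = conv°((1,0),(0,0),(c,-1))`. -/
theorem statement6 (c : ℝ) :
    q2c c ≠ 0 ∧
      ∀ u : MvPolynomial (Fin 2) ℝ,
        (inPerp 2 (0, 0) (1, 0) (0, 1) u ∧ inPerp 2 (1, 0) (0, 0) (c, -1) u) ↔
          ∃ t : ℝ, u = t • q2c c := by
  refine ⟨q2c_ne_zero c, fun u ↦ ⟨?_, ?_⟩⟩
  · rintro ⟨h, h'⟩
    obtain ⟨a, rfl⟩ := exists_quadratic h.1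
    obtain ⟨t, rfl⟩ := (isOrthogonal_and_shearCoeff_iff c a).1
      ⟨(inPerp_unit_iff a).1 h, (inPerp_sheared_iff c a).1 h'⟩
    exact ⟨t, (smul_q2c t c).symm⟩
  · rintro ⟨t, rfl⟩
    rw [smul_q2c, inPerp_unit_iff, inPerp_sheared_iff, isOrthogonal_and_shearCoeff_iff]
    exact ⟨t, rfl⟩
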